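/- Let n ≥ 3 be an integer, let U be a neighborhood of the origin in ℝ², and let φ : U → ℝ be of class Cⁿ satisfying ∂₂²φ(0,0) = 0, ∂₁∂₂²φ(0,0) = 0 and ∂₂³φ(0,0) ≠ 0. Then there exist sufficiently small positive real numbers δ₁, δ₂ with (−δ₁,δ₁)×(−δ₂,δ₂) ⊆ U, a function ψ : (−δ₁,δ₁) → (−δ₂,δ₂) of class C^{n−2} with ψ(0) = 0 and ψ'(0) = 0, and a function B of class C^{n−3} on (−δ₁,δ₁)×(−δ₂,δ₂) with B(0,0) ≠ 0, such that for all (x₁,x₂) ∈ (−δ₁,δ₁)×(−δ₂,δ₂) one has φ(x₁,x₂) = φ(x₁,ψ(x₁)) + ∂₂φ(x₁,ψ(x₁))·(x₂ − ψ(x₁)) + B(x₁,x₂)·(x₂ − ψ(x₁))³. -/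

import Mathlib

open Set

open scoped Topology ContDiff

section ParametricIntegral

universe u

variable {E : Type u} [NormedAddCommGroup E] [NormedSpace ℝ E] [FiniteDimensional ℝ E]

/-- Differentiation under the integral sign for a `C¹` integrand on a compact interval. -/
theorem hasFDerivAt_intervalIntegral_of_contDiff {F : Type*} [NormedAddCommGroup F]
    [NormedSpace ℝ F] {K : E × ℝ → F} (hK : ContDiff ℝ 1 K) (a b : ℝ) (x : E) :
    HasFDerivAt (fun x => ∫ t in a..b, K (x, t))
      (∫ t in a..b, (fderiv ℝ K (x, t)) ∘L .inl ℝ E ℝ) x := by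
  have hc : Continuous fun p : E × ℝ => (fderiv ℝ K p) ∘L .inl ℝ E ℝ :=
    (hK.continuous_fderiv one_ne_zero).clm_comp continuous_const
  obtain ⟨C, hC⟩ := ((isCompact_closedBall x 1).prod
    (isCompact_uIcc (a := a) (b := b))).exists_bound_of_continuousOn hc.continuousOn
  refine (intervalIntegral.hasFDerivAt_integral_of_dominated_of_fderiv_le
    (F' := fun y t => (fderiv ℝ K (y, t)) ∘L .inl ℝ E ℝ) (bound := fun _ => C)
    (Metric.ball_mem_nhds x one_pos) ?_ ?_ ?_ ?_ ?_ ?_)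
  · exact .of_forall fun y => (hK.continuous.comp (by fun_prop)).aestronglyMeasurable
  · exact (hK.continuous.comp (by fun_prop)).intervalIntegrable _ _
  · exact (hc.comp (by fun_prop : Continuous fun t : ℝ => (x, t))).aestronglyMeasurable
  · exact .of_forall fun t ht y hy =>
      hC (y, t) ⟨Metric.ball_subset_closedBall hy, uIoc_subset_uIcc ht⟩
  · exact intervalIntegrable_const
  · exact .of_forall fun t _ y _ =>
      ((hK.differentiable one_ne_zero (y, t)).hasFDerivAt).comp y (hasFDerivAt_prodMk_left y t)

theorem contDiff_intervalIntegral_of_contDiff {F : Type u} [NormedAddCommGroup F]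
    [NormedSpace ℝ F] {m : ℕ} {K : E × ℝ → F} (hK : ContDiff ℝ m K) (a b : ℝ) :
    ContDiff ℝ m fun x => ∫ t in a..b, K (x, t) := by
  induction m generalizing F with
  | zero =>
    rw [Nat.cast_zero, contDiff_zero] at hK ⊢
    exact intervalIntegral.continuous_parametric_intervalIntegral_of_continuous'
      (f := fun x t => K (x, t)) hK a b
  | succ m ih =>
    rw [Nat.cast_succ] at hK ⊢
    refine contDiff_succ_iff_hasFDerivAt.2 ⟨_, ?_, fun x =>
      hasFDerivAt_intervalIntegral_of_contDiff (hK.of_le le_add_self) a b x⟩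
    exact ih (K := fun p => (fderiv ℝ K p) ∘L .inl ℝ E ℝ)
      ((hK.fderiv_right le_rfl).clm_comp contDiff_const)

end ParametricIntegral

/-- A function that is `Cᵏ` near a point agrees near that point with a global `Cᵏ` function. -/
theorem ContDiffOn.exists_contDiff_eventuallyEq {E F : Type*} [NormedAddCommGroup E]
    [NormedSpace ℝ E] [FiniteDimensional ℝ E] [NormedAddCommGroup F] [NormedSpace ℝ F]
    {k : ℕ∞} {s : Set E} {f : E → F} {x : E} (hf : ContDiffOn ℝ k f s) (hs : s ∈ 𝓝 x) :
    ∃ g : E → F, ContDiff ℝ k g ∧ g =ᶠ[𝓝 x] f := by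
  obtain ⟨r, hr, hrs⟩ := Metric.mem_nhds_iff.1 hs
  let χ : ContDiffBump x := ⟨r / 4, r / 2, by positivity, by linarith⟩
  refine ⟨fun y => χ y • f y, contDiff_iff_contDiffAt.2 fun y => ?_, ?_⟩
  · by_cases hy : y ∈ tsupport χ
    · rw [χ.tsupport_eq] at hy
      have hy' : y ∈ Metric.ball x r :=
        Metric.closedBall_subset_ball (by change r / 2 < r; linarith) hy
      exact χ.contDiffAt.smul
        ((hf.mono hrs).contDiffAt (Metric.isOpen_ball.mem_nhds hy'))
    · refine (contDiffAt_const (c := (0 : F))).congr_of_eventuallyEq ?_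
      filter_upwards [notMem_tsupport_iff_eventuallyEq.1 hy] with z hz
      simp [hz]
  · filter_upwards [χ.eventuallyEq_one] with y hy
    simp [hy]

/-- The `k`-th iterated partial derivative with respect to the second coordinate. -/
noncomputable def iteratedPartialSnd (k : ℕ) (f : ℝ × ℝ → ℝ) (x : ℝ × ℝ) : ℝ :=
  iteratedDeriv k (fun t => f (x.1, t)) x.2

theorem iteratedPartialSnd_succ {k : ℕ} {f : ℝ × ℝ → ℝ}
    (h : Differentiable ℝ (iteratedPartialSnd k f)) (x : ℝ × ℝ) :
    iteratedPartialSnd (k + 1) f x = fderiv ℝ (iteratedPartialSnd k f) x (0, 1) := by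
  have h1 := (h x).hasFDerivAt.comp_hasDerivAt x.2
    ((hasDerivAt_const x.2 x.1).prodMk (hasDerivAt_id x.2))
  rw [iteratedPartialSnd, iteratedDeriv_succ]
  exact h1.deriv

theorem contDiff_iteratedPartialSnd {m k : ℕ} {f : ℝ × ℝ → ℝ} (hf : ContDiff ℝ (m + k : ℕ) f) :
    ContDiff ℝ m (iteratedPartialSnd k f) := by
  induction k generalizing m with
  | zero => simpa [show iteratedPartialSnd 0 f = f from rfl] using hf
  | succ k ih =>
    have h : ContDiff ℝ (m + 1 : ℕ) (iteratedPartialSnd k f) := ih (by convert hf using 2; ring)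
    rw [funext (iteratedPartialSnd_succ (h.differentiable (by simp)))]
    exact (h.fderiv_right (by simp)).clm_apply contDiff_const

theorem iteratedPartialSnd_congr {f g : ℝ × ℝ → ℝ} {x : ℝ × ℝ} (h : f =ᶠ[𝓝 x] g) (k : ℕ) :
    iteratedPartialSnd k f x = iteratedPartialSnd k g x := by
  refine Filter.EventuallyEq.iteratedDeriv_eq k ?_
  exact (by fun_prop : Continuous fun t : ℝ => (x.1, t)).continuousAt.eventually h

/-- The factor `R` in the Taylor expansion to second order in the second coordinate. -/
noncomputable def taylorCubicFactor (f : ℝ × ℝ → ℝ) (p : ℝ × ℝ × ℝ) : ℝ :=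
  2⁻¹ * ∫ s in (0 : ℝ)..1,
    (1 - s) ^ 2 * iteratedPartialSnd 3 f (p.1, p.2.1 + s * (p.2.2 - p.2.1))

theorem contDiff_taylorCubicFactor {m : ℕ} {f : ℝ × ℝ → ℝ} (hf : ContDiff ℝ (m + 3 : ℕ) f) :
    ContDiff ℝ m (taylorCubicFactor f) := by
  have h := contDiff_iteratedPartialSnd hf
  have hK : ContDiff ℝ m fun q : (ℝ × ℝ × ℝ) × ℝ => (1 - q.2) ^ 2 *
      iteratedPartialSnd 3 f (q.1.1, q.1.2.1 + q.2 * (q.1.2.2 - q.1.2.1)) := by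
    fun_prop
  exact contDiff_const.mul (contDiff_intervalIntegral_of_contDiff hK 0 1)

theorem taylorCubicFactor_diag (f : ℝ × ℝ → ℝ) (a b : ℝ) :
    taylorCubicFactor f (a, b, b) = iteratedPartialSnd 3 f (a, b) / 6 := by
  have h : ∫ s in (0 : ℝ)..1, (1 - s) ^ 2 = 1 / 3 := by
    rw [intervalIntegral.integral_comp_sub_left (fun s => s ^ 2) 1]
    norm_num
  simp only [taylorCubicFactor, sub_self, mul_zero, add_zero,
    intervalIntegral.integral_mul_const, h]
  ring

theorem eq_taylor_add_taylorCubicFactor {f : ℝ × ℝ → ℝ} (hf : ContDiff ℝ 3 f) (a b c : ℝ) :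
    f (a, c) = f (a, b) + deriv (fun t => f (a, t)) b * (c - b)
      + 2⁻¹ * iteratedPartialSnd 2 f (a, b) * (c - b) ^ 2
      + taylorCubicFactor f (a, b, c) * (c - b) ^ 3 := by
  have hg : ContDiff ℝ (2 + 1) fun t => f (a, t) := by
    norm_num
    fun_prop
  have key := map_add_eq_sum_add_integral_iteratedFDeriv (n := 2) (x := b) (y := c - b)
    (fun t _ => hg.contDiffAt)
  simp only [iteratedFDeriv_apply_eq_iteratedDeriv_mul_prod, Finset.prod_const, Finset.card_univ,
    Fintype.card_fin, Finset.sum_range_succ, Finset.sum_range_zero, smul_eq_mul,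
    add_sub_cancel, iteratedDeriv_zero, iteratedDeriv_one] at key
  rw [key, taylorCubicFactor, mul_assoc _ _ ((c - b) ^ 3), ← intervalIntegral.integral_mul_const]
  simp only [iteratedPartialSnd, Nat.factorial]
  have : (fun s : ℝ => (1 - s) ^ 2 * ((c - b) ^ (2 + 1) *
        iteratedDeriv (2 + 1) (fun t => f (a, t)) (b + s * (c - b)))) =
      fun s => (1 - s) ^ 2 * iteratedDeriv 3 (fun t => f (a, t)) (b + s * (c - b)) *
        (c - b) ^ 3 := by
    funext s; ring
  rw [this]
  norm_num
  ring

/-- A scalar implicit function theorem at a point where the first partial derivative vanishes. -/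
theorem exists_implicitFunction_of_partial_eq_zero {m : ℕ} (hm : m ≠ 0) {f : ℝ × ℝ → ℝ}
    (hf : ContDiffAt ℝ m f 0) (h0 : f 0 = 0) (h1 : fderiv ℝ f 0 (1, 0) = 0)
    (h2 : fderiv ℝ f 0 (0, 1) ≠ 0) :
    ∃ ψ : ℝ → ℝ, ContDiffAt ℝ m ψ 0 ∧ ψ 0 = 0 ∧ deriv ψ 0 = 0 ∧ ∀ᶠ x in 𝓝 0, f (x, ψ x) = 0 := by
  have hm' : (m : ℕ∞ω) ≠ 0 := by exact_mod_cast hm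
  have hinv : (fderiv ℝ f 0 ∘L .inr ℝ ℝ ℝ).IsInvertible := by
    refine ⟨ContinuousLinearEquiv.unitsEquivAut ℝ (Units.mk0 _ h2), ?_⟩
    ext
    simp
  refine ⟨hf.implicitFunction hm' hinv, hf.contDiffAt_implicitFunction hm' hinv,
    hf.implicitFunction_apply_self hm' hinv, ?_, ?_⟩
  · have := (hf.hasStrictFDerivAt_implicitFunction hm' hinv).hasFDerivAt.hasDerivAt.deriv
    simpa [h1] using this
  · simpa [h0] using hf.eventually_apply_implicitFunction hm' hinv

theorem natCast_add_sub_natCast_withTop (a b : ℕ) : ((a + b : ℕ) : ℕ∞ω) - (b : ℕ) = a := by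
  have : (((a + b : ℕ) : ℕ∞) - (b : ℕ) : ℕ∞) = a := by
    rw [← ENat.natCast_sub]; simp
  exact congrArg ((↑) : ℕ∞ → ℕ∞ω) this

/-- `Cⁿ` version (`n ≥ 3`) of the decomposition: `ψ` is `C^{n-2}` on
`(-δ₁,δ₁)` with values in `(-δ₂,δ₂)`, and `B` is `C^{n-3}` on the rectangle, with
`φ(x₁,x₂) = φ(x₁,ψ x₁) + ∂₂φ(x₁, ψ x₁)·(x₂ - ψ x₁) + B(x₁,x₂)·(x₂ - ψ x₁)³`. -/
theorem stmt_1 (n : ℕ) (hn : 3 ≤ n) (U : Set (ℝ × ℝ)) (hU : U ∈ nhds (0 : ℝ × ℝ))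
    (φ : ℝ × ℝ → ℝ) (hφ : ContDiffOn ℝ n φ U)
    (h22 : iteratedDeriv 2 (fun t => φ (0, t)) 0 = 0)
    (h122 : deriv (fun s => iteratedDeriv 2 (fun t => φ (s, t)) 0) 0 = 0)
    (h222 : iteratedDeriv 3 (fun t => φ (0, t)) 0 ≠ 0) :
    ∃ δ₁ δ₂ : ℝ, 0 < δ₁ ∧ 0 < δ₂ ∧ Ioo (-δ₁) δ₁ ×ˢ Ioo (-δ₂) δ₂ ⊆ U ∧
      ∃ ψ : ℝ → ℝ, MapsTo ψ (Ioo (-δ₁) δ₁) (Ioo (-δ₂) δ₂) ∧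
        ContDiffOn ℝ (n - 2) ψ (Ioo (-δ₁) δ₁) ∧ ψ 0 = 0 ∧ deriv ψ 0 = 0 ∧
        ∃ B : ℝ × ℝ → ℝ, ContDiffOn ℝ (n - 3) B (Ioo (-δ₁) δ₁ ×ˢ Ioo (-δ₂) δ₂) ∧
          B (0, 0) ≠ 0 ∧
          ∀ x ∈ Ioo (-δ₁) δ₁ ×ˢ Ioo (-δ₂) δ₂, φ x = φ (x.1, ψ x.1) +
            deriv (fun t => φ (x.1, t)) (ψ x.1) * (x.2 - ψ x.1) +
            B x * (x.2 - ψ x.1) ^ 3 := by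
  obtain ⟨m, rfl⟩ := Nat.exists_eq_add_of_le' hn
  obtain ⟨Φ, hΦ, hΦφ⟩ := ContDiffOn.exists_contDiff_eventuallyEq (k := (m + 3 : ℕ)) hφ hU
  replace hΦ : ContDiff ℝ (m + 3 : ℕ) Φ := hΦ
  have hf : ContDiff ℝ (m + 1 : ℕ) (iteratedPartialSnd 2 Φ) := contDiff_iteratedPartialSnd hΦ
  have hd : Differentiable ℝ (iteratedPartialSnd 2 Φ) := hf.differentiable (by simp)
  have hpartial (k : ℕ) : ∀ᶠ x in 𝓝 (0 : ℝ × ℝ),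
      iteratedPartialSnd k Φ x = iteratedPartialSnd k φ x :=
    hΦφ.eventually_nhds.mono fun x hx => iteratedPartialSnd_congr hx k
  have e2 : iteratedPartialSnd 2 Φ 0 = 0 := (hpartial 2).self_of_nhds.trans h22
  have e3 : iteratedPartialSnd 3 Φ 0 ≠ 0 := fun h => h222 ((hpartial 3).self_of_nhds.symm.trans h)
  have e12 : fderiv ℝ (iteratedPartialSnd 2 Φ) 0 (1, 0) = 0 := by
    have h := (hd (0, 0)).hasFDerivAt.comp_hasDerivAt (f := fun s : ℝ => (s, (0 : ℝ))) (0 : ℝ)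
      ((hasDerivAt_id (0 : ℝ)).prodMk (hasDerivAt_const (0 : ℝ) (0 : ℝ)))
    refine h.deriv.symm.trans (Eq.trans (Filter.EventuallyEq.deriv_eq ?_) h122)
    exact (by fun_prop : Continuous fun s : ℝ => (s, (0 : ℝ))).continuousAt.eventually (hpartial 2)
  obtain ⟨ψ, hψ, hψ0, hψ', hψf⟩ := exists_implicitFunction_of_partial_eq_zero m.succ_ne_zero
    hf.contDiffAt e2 e12 (by rwa [← iteratedPartialSnd_succ hd])
  obtain ⟨ε, hε, hεW⟩ := Metric.eventually_nhds_iff_ball.1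
    (hΦφ.eventually_nhds.and (Filter.eventually_mem_set.2 hU))
  have hψε : ∀ᶠ x in 𝓝 0, ψ x ∈ Ioo (-ε) ε :=
    hψ.continuousAt.eventually (Ioo_mem_nhds (by rw [hψ0]; linarith) (by rw [hψ0]; linarith))
  obtain ⟨δ, hδ, hδψ⟩ := Metric.eventually_nhds_iff_ball.1
    (hψε.and (hψf.and (hψ.eventually (by simp))))
  have hball (r : ℝ) : Metric.ball (0 : ℝ) r = Ioo (-r) r := by simp [Real.ball_eq_Ioo]
  have hrect : Ioo (-min δ ε) (min δ ε) ×ˢ Ioo (-ε) ε ⊆ Metric.ball (0 : ℝ × ℝ) ε := by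
    rw [← hball, ← hball, ← Prod.mk_zero_zero, ← ball_prod_same]
    exact prod_mono (Metric.ball_subset_ball (min_le_right _ _)) subset_rfl
  rw [hball] at hδψ
  have hsub : Ioo (-min δ ε) (min δ ε) ⊆ Ioo (-δ) δ :=
    Ioo_subset_Ioo (neg_le_neg (min_le_left _ _)) (min_le_left _ _)
  have hψon : ContDiffOn ℝ (m + 1 : ℕ) ψ (Ioo (-min δ ε) (min δ ε)) :=
    fun x hx => (hδψ x (hsub hx)).2.2.contDiffWithinAt
  have hψmaps : MapsTo ψ (Ioo (-min δ ε) (min δ ε)) (Ioo (-ε) ε) :=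
    fun x hx => (hδψ x (hsub hx)).1
  refine ⟨min δ ε, ε, lt_min hδ hε, hε, fun x hx => (hεW x (hrect hx)).2, ψ, hψmaps, ?_, hψ0, hψ',
    fun x => taylorCubicFactor Φ (x.1, ψ x.1, x.2), ?_, ?_, ?_⟩
  · exact (natCast_add_sub_natCast_withTop (m + 1) 2).symm ▸ hψon
  · have hB : ContDiffOn ℝ m (fun x : ℝ × ℝ => taylorCubicFactor Φ (x.1, ψ x.1, x.2))
        (Ioo (-min δ ε) (min δ ε) ×ˢ Ioo (-ε) ε) :=
      (contDiff_taylorCubicFactor hΦ).comp_contDiffOn (contDiffOn_fst.prodMk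
        (((hψon.of_le (by simp)).comp contDiffOn_fst fun x hx => hx.1).prodMk contDiffOn_snd))
    exact (natCast_add_sub_natCast_withTop m 3).symm ▸ hB
  · simp only [hψ0, taylorCubicFactor_diag]
    exact div_ne_zero e3 (by norm_num)
  · rintro ⟨a, c⟩ hx
    have hψx : (a, ψ a) ∈ Metric.ball (0 : ℝ × ℝ) ε := hrect ⟨hx.1, hψmaps hx.1⟩
    have hderiv := iteratedPartialSnd_congr (hεW _ hψx).1 1
    simp only [iteratedPartialSnd, iteratedDeriv_one] at hderiv
    have key := eq_taylor_add_taylorCubicFactor (hΦ.of_le (by simp)) a (ψ a) c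
    rw [(hδψ a (hsub hx.1)).2.1, (hεW _ (hrect hx)).1.self_of_nhds,
      (hεW _ hψx).1.self_of_nhds, hderiv] at key
    simpa using key
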